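/- Let P be a finite poset and let Ch(P) be the poset of nonempty chains of P ordered by inclusion. Then the Möbius number of P equals the Möbius number of Ch(P): μ(P) = μ(Ch(P)). -/

import Mathlib

open scoped Classical

instance {β : Type*} [Fintype β] : Fintype (WithTop β) := inferInstanceAs (Fintype (Option β))
instance {β : Type*} [Fintype β] : Fintype (WithBot β) := inferInstanceAs (Fintype (Option β))

/-- `mu` is the Möbius function of the finite poset `β`. -/
def IsMobiusFn {β : Type*} [PartialOrder β] [Fintype β] (mu : β → β → ℤ) : Prop :=
  (∀ x y : β, ¬ x ≤ y → mu x y = 0) ∧ (∀ x : β, mu x x = 1) ∧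
    (∀ x y : β, x < y → mu x y = - ∑ z : β, if x ≤ z ∧ z < y then mu x z else 0)

/-- `Ch(P)`: the poset of nonempty chains of `P`, partially ordered by inclusion. -/
def ChainPoset (P : Type*) [PartialOrder P] : Type _ :=
  {s : Finset P // s.Nonempty ∧ IsChain (· ≤ ·) (↑s : Set P)}

instance {P : Type*} [PartialOrder P] : PartialOrder (ChainPoset P) :=
  Subtype.partialOrder _

noncomputable instance {P : Type*} [PartialOrder P] [Fintype P] : Fintype (ChainPoset P) :=
  Subtype.fintype _

theorem sum_withBotTop {P : Type*} [Fintype P] (F : WithBot (WithTop P) → ℤ) :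
    ∑ z, F z = F ⊥ + (F (((⊤ : WithTop P)) : WithBot (WithTop P)) +
      ∑ p : P, F ((p : WithTop P) : WithBot (WithTop P))) := by
  have h1 := Fintype.sum_option (α := WithTop P) (fun z : Option (WithTop P) => F z)
  have h2 := Fintype.sum_option (α := P)
    (fun z : Option P => F (WithBot.some (z : WithTop P)))
  refine h1.trans ?_
  refine congrArg (F ⊥ + ·) ?_
  exact h2

theorem mob_coe {P : Type*} [PartialOrder P] [Fintype P]
    (mu : WithBot (WithTop P) → WithBot (WithTop P) → ℤ) (h : IsMobiusFn mu) (x : P) :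
    mu ⊥ ((x : WithTop P) : WithBot (WithTop P)) =
      - (1 + ∑ z : P, if z < x then mu ⊥ ((z : WithTop P) : WithBot (WithTop P)) else 0) := by
  rw [h.2.2 _ _ (WithBot.bot_lt_coe _), sum_withBotTop]
  simp [h.2.1, WithBot.coe_lt_coe, WithTop.coe_lt_coe, -WithBot.coe_top]

theorem mob_top {P : Type*} [PartialOrder P] [Fintype P]
    (mu : WithBot (WithTop P) → WithBot (WithTop P) → ℤ) (h : IsMobiusFn mu) :
    mu ⊥ ⊤ =
      - (1 + ∑ z : P, mu ⊥ ((z : WithTop P) : WithBot (WithTop P))) := by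
  have e : (⊤ : WithBot (WithTop P)) = ((⊤ : WithTop P) : WithBot (WithTop P)) := rfl
  rw [e, h.2.2 _ _ (WithBot.bot_lt_coe _), sum_withBotTop]
  simp [h.2.1, WithBot.coe_lt_coe, WithTop.coe_lt_top, -WithBot.coe_top]

/-- signed count of all chains (the empty one included) inside `U` -/
noncomputable def chainSum {P : Type*} [PartialOrder P] (U : Finset P) : ℤ :=
  ∑ s ∈ U.powerset, if IsChain (· ≤ ·) (↑s : Set P) then (-1 : ℤ) ^ s.card else 0

theorem chainSum_lower {P : Type*} [PartialOrder P] [Fintype P] (f : P → ℤ)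
    (hf : ∀ x, f x = - (1 + ∑ z : P, if z < x then f z else 0)) (n : ℕ) :
    ∀ U : Finset P, U.card = n → (∀ x ∈ U, ∀ y, y ≤ x → y ∈ U) →
      1 + ∑ x ∈ U, f x = chainSum U := by
  induction n using Nat.strong_induction_on with
  | _ n ih =>
  intro U hU hlow
  rcases U.eq_empty_or_nonempty with rfl | hne
  · simp [chainSum]
  obtain ⟨x, hxU, hmax⟩ := U.exists_maximal hne
  obtain ⟨V, hxV, rfl⟩ : ∃ V, x ∉ V ∧ insert x V = U :=
    ⟨U.erase x, by simp, Finset.insert_erase hxU⟩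
  have hVlow : ∀ a ∈ V, ∀ y, y ≤ a → y ∈ V := by
    intro a ha y hy
    have h1 := hlow a (Finset.mem_insert_of_mem ha) y hy
    rcases Finset.mem_insert.1 h1 with rfl | h1
    · exact absurd (le_antisymm hy (hmax (Finset.mem_insert_of_mem ha) hy)) (by
        rintro rfl; exact hxV ha)
    · exact h1
  set W : Finset P := Finset.univ.filter (· < x) with hW
  have hWV : W ⊆ V := by
    intro a ha
    have ha : a < x := by simpa [hW] using ha
    have h1 := hlow x (Finset.mem_insert_self _ _) a ha.le
    exact (Finset.mem_insert.1 h1).resolve_left ha.ne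
  have hWlow : ∀ a ∈ W, ∀ y, y ≤ a → y ∈ W := by
    intro a ha y hy
    simp only [hW, Finset.mem_filter, Finset.mem_univ, true_and] at ha ⊢
    exact hy.trans_lt ha
  rw [Finset.card_insert_of_notMem hxV] at hU
  have hV := ih V.card (by omega) V rfl hVlow
  have hWc := Finset.card_le_card hWV
  have hW' := ih W.card (by omega) W rfl hWlow
  have hfx := hf x
  rw [← Finset.sum_filter] at hfx
  have key : chainSum (insert x V) = chainSum V - chainSum W := by
    unfold chainSum
    rw [Finset.sum_powerset_insert hxV, sub_eq_add_neg, ← Finset.sum_neg_distrib]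
    congr 1
    symm
    have hsub : W.powerset ⊆ V.powerset := Finset.powerset_mono.2 hWV
    refine (Finset.sum_subset_zero_on_sdiff hsub ?_ ?_)
    · intro t ht
      rw [Finset.mem_sdiff, Finset.mem_powerset, Finset.mem_powerset] at ht
      rw [if_neg]
      intro hc
      apply ht.2
      intro a ha
      have hne : a ≠ x := by rintro rfl; exact hxV (ht.1 ha)
      have hcmp := hc (show a ∈ (↑(insert x t) : Set P) by simp [ha])
        (show x ∈ (↑(insert x t) : Set P) by simp) hne
      have hle : a ≤ x := by
        rcases hcmp with h | h
        · exact h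
        · exact hmax (Finset.mem_insert_of_mem (ht.1 ha)) h
      simp [hW, lt_of_le_of_ne hle hne]
    · intro t ht
      rw [Finset.mem_powerset] at ht
      have hxt : x ∉ t := fun h => hxV (hWV (ht h))
      have hiff : IsChain (· ≤ ·) (↑(insert x t) : Set P) ↔ IsChain (· ≤ ·) (↑t : Set P) := by
        constructor
        · intro h; exact h.mono (by simp)
        · intro h
          rw [Finset.coe_insert]
          refine h.insert ?_
          intro b hb _
          right
          have := ht hb
          simp only [hW, Finset.mem_filter, Finset.mem_univ, true_and] at this
          exact this.le
      rw [Finset.card_insert_of_notMem hxt]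
      by_cases hc : IsChain (· ≤ ·) (↑t : Set P)
      · rw [if_pos hc, if_pos (hiff.2 hc)]; ring
      · rw [if_neg hc, if_neg (mt hiff.1 hc)]; simp
  rw [Finset.sum_insert hxV, key, ← hV, ← hW', hfx]
  ring

theorem chain_mob {P : Type*} [PartialOrder P] [Fintype P] (g : ChainPoset P → ℤ)
    (hg : ∀ x, g x = - (1 + ∑ z, if z < x then g z else 0)) (n : ℕ) :
    ∀ s : ChainPoset P, s.1.card = n → g s = (-1) ^ s.1.card := by
  induction n using Nat.strong_induction_on with
  | _ n ih =>
  intro s hs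
  rw [hg s, ← Finset.sum_filter]
  have h1 : ∑ t ∈ Finset.univ.filter (· < s), g t
      = ∑ t ∈ (s.1.powerset.erase ∅).erase s.1, (-1 : ℤ) ^ t.card := by
    refine Finset.sum_bij (fun t _ => t.1) ?_ ?_ ?_ ?_
    · intro t ht
      have ht : t < s := by simpa using ht
      simp only [Finset.mem_erase, Finset.mem_powerset]
      exact ⟨fun h => ht.ne (Subtype.ext h), t.2.1.ne_empty, ht.le⟩
    · intro a _ b _ h
      exact Subtype.ext h
    · intro b hb
      simp only [Finset.mem_erase, Finset.mem_powerset] at hb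
      refine ⟨⟨b, Finset.nonempty_iff_ne_empty.2 hb.2.1, s.2.2.mono (by exact_mod_cast hb.2.2)⟩,
        ?_, rfl⟩
      refine Finset.mem_filter.2 ⟨Finset.mem_univ _, ?_⟩
      exact lt_of_le_of_ne hb.2.2 (fun h => hb.1 (congrArg Subtype.val h))
    · intro t ht
      have ht : t < s := by simpa using ht
      have hss : t.1 ⊂ s.1 := lt_of_le_of_ne (show t.1 ≤ s.1 from ht.le) (fun h => ht.ne (Subtype.ext h))
      exact ih t.1.card (hs ▸ Finset.card_lt_card hss) t rfl
  have h2 : ∑ t ∈ s.1.powerset, (-1 : ℤ) ^ t.card = 0 :=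
    Finset.sum_powerset_neg_one_pow_card_of_nonempty s.2.1
  rw [← Finset.add_sum_erase _ _ (Finset.empty_mem_powerset s.1),
    ← Finset.add_sum_erase _ _ (show s.1 ∈ s.1.powerset.erase ∅ from
      Finset.mem_erase.2 ⟨s.2.1.ne_empty, Finset.mem_powerset_self _⟩)] at h2
  rw [h1]
  simp only [Finset.card_empty, pow_zero] at h2
  linarith

theorem sum_chains {P : Type*} [PartialOrder P] [Fintype P] :
    1 + ∑ s : ChainPoset P, (-1 : ℤ) ^ s.1.card = chainSum (Finset.univ : Finset P) := by
  unfold chainSum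
  rw [← Finset.sum_filter, ← Finset.add_sum_erase _ _ (show (∅ : Finset P) ∈ _ by simp)]
  simp only [Finset.card_empty, pow_zero]
  congr 1
  refine Finset.sum_bij (fun t _ => t.1) ?_ ?_ ?_ ?_
  · intro t _
    simp [t.2.1.ne_empty, t.2.2]
  · intro a _ b _ h
    exact Subtype.ext h
  · intro b hb
    simp only [Finset.mem_erase, Finset.mem_filter] at hb
    exact ⟨⟨b, Finset.nonempty_iff_ne_empty.2 hb.1, hb.2.2⟩, Finset.mem_univ _, rfl⟩
  · intros; rfl

/-- The Möbius number of a finite poset `P` equals the Möbius number of its poset of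
nonempty chains `Ch(P)`:  `μ(P) = μ(Ch(P))`. -/
theorem mobius_number_eq_mobius_number_chains {P : Type*} [PartialOrder P] [Fintype P]
    (muP : WithBot (WithTop P) → WithBot (WithTop P) → ℤ) (hmuP : IsMobiusFn muP)
    (muC : WithBot (WithTop (ChainPoset P)) → WithBot (WithTop (ChainPoset P)) → ℤ)
    (hmuC : IsMobiusFn muC) :
    muP ⊥ ⊤ = muC ⊥ ⊤ := by
  rw [mob_top muP hmuP, mob_top muC hmuC,
    chainSum_lower (fun x : P => muP ⊥ ((x : WithTop P) : WithBot (WithTop P)))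
      (mob_coe muP hmuP) _ Finset.univ rfl (by simp), ← sum_chains]
  congr 2
  refine Finset.sum_congr rfl fun s _ => ?_
  exact (chain_mob (fun x : ChainPoset P => muC ⊥ ((x : WithTop (ChainPoset P)) : WithBot (WithTop (ChainPoset P))))
    (mob_coe muC hmuC) _ s rfl).symm
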